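/- In the Reflection Equation algebra L(R) defined by R L₁ R L₁ = L₁ R L₁ R for a skew-invertible even Hecke symmetry R of bi-rank (m|0), the matrix product L_{1̄}L_{2̄}⋯L_{m̄} (where L_{1̄}=L₁ and L_{k+1 bar} = R_k L_{k̄} R_k⁻¹) commutes with P⁽ᵐ⁾ and P⁽ᵐ⁾ L_{1̄}⋯L_{m̄} = L_{1̄}⋯L_{m̄} P⁽ᵐ⁾ = q^{m²} det_{RE}(L) · P⁽ᵐ⁾, where det_{RE}(L) = Tr_{R(1…m)}(P⁽ᵐ⁾ L_{1̄}⋯L_{m̄}). -/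

import Mathlib

open Matrix BigOperators

variable {K : Type*} [Field K]

def liftPos (k N : ℕ) (R : Matrix (Fin N × Fin N) (Fin N × Fin N) K) (i : ℕ) :
    Matrix (Fin k → Fin N) (Fin k → Fin N) K :=
  if h : i + 1 < k then
    Matrix.of (fun f g =>
      R (f ⟨i, Nat.lt_of_succ_lt h⟩, f ⟨i + 1, h⟩)
          (g ⟨i, Nat.lt_of_succ_lt h⟩, g ⟨i + 1, h⟩) *
        ∏ t ∈ Finset.univ.filter (fun t : Fin k => (t : ℕ) ≠ i ∧ (t : ℕ) ≠ i + 1),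
          (if f t = g t then 1 else 0))
  else 1

def qInt (q : K) (n : ℕ) : K := (q ^ n - q⁻¹ ^ n) / (q - q⁻¹)

def skewSym (k N : ℕ) (q : K) (R : Matrix (Fin N × Fin N) (Fin N × Fin N) K) :
    ℕ → Matrix (Fin k → Fin N) (Fin k → Fin N) K
  | 0 => 1
  | 1 => 1
  | (n + 2) =>
      (qInt q (n + 1) / qInt q (n + 2)) •
        (skewSym k N q R (n + 1) *
          ((q ^ (n + 1) / qInt q (n + 1)) • (1 : Matrix (Fin k → Fin N) (Fin k → Fin N) K) -
            liftPos k N R n) *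
          skewSym k N q R (n + 1))

/-- L₁ = L ⊗ I^{⊗(m−1)}: the matrix L placed in the first tensor factor. -/
def embed1 (m N : ℕ) (hm : 0 < m) {A : Type*} [Ring A]
    (L : Matrix (Fin N) (Fin N) A) :
    Matrix (Fin m → Fin N) (Fin m → Fin N) A :=
  Matrix.of fun f g =>
    L (f ⟨0, hm⟩) (g ⟨0, hm⟩) *
      (if ∀ t : Fin m, (t : ℕ) ≠ 0 → f t = g t then 1 else 0)

/-- The barred copies L_{k̄}: L_{1̄} = L₁ and L_{k+1 bar} = R_k L_{k̄} R_k⁻¹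
(here `Lbar … n` is L_{n+1 bar}). -/
def Lbar (m N : ℕ) (hm : 0 < m) {A : Type*} [Ring A] [Algebra K A]
    (R Rinv : Matrix (Fin N × Fin N) (Fin N × Fin N) K)
    (L : Matrix (Fin N) (Fin N) A) :
    ℕ → Matrix (Fin m → Fin N) (Fin m → Fin N) A
  | 0 => embed1 m N hm L
  | (n + 1) =>
      (liftPos m N R n).map (algebraMap K A) *
        Lbar m N hm R Rinv L n *
        (liftPos m N Rinv n).map (algebraMap K A)

/-- The tower of `q`-antisymmetrizers built from a sequence of braid generators. -/
def antisymmetrizer {B : Type*} [Ring B] [Algebra K B] (q : K) (r : ℕ → B) : ℕ → B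
  | 0 => 1
  | 1 => 1
  | (n + 2) =>
      (qInt q (n + 1) / qInt q (n + 2)) •
        (antisymmetrizer q r (n + 1) * ((q ^ (n + 1) / qInt q (n + 1)) • (1 : B) - r n) *
          antisymmetrizer q r (n + 1))

section Antisymmetrizer

variable {B : Type*} [Ring B] [Algebra K B]

theorem skewSym_eq_antisymmetrizer (k N : ℕ) (q : K)
    (R : Matrix (Fin N × Fin N) (Fin N × Fin N) K) (n : ℕ) :
    skewSym k N q R n = antisymmetrizer q (liftPos k N R) n := by
  induction n using Nat.twoStepInduction with
  | zero => rfl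
  | one => rfl
  | more n _ ih => simp only [skewSym, antisymmetrizer, ih]

theorem map_antisymmetrizer {B' : Type*} [Ring B'] [Algebra K B'] (φ : B →ₐ[K] B') (q : K)
    (r : ℕ → B) (r' : ℕ → B') (n : ℕ) (h : ∀ i, i + 1 < n → φ (r i) = r' i) :
    φ (antisymmetrizer q r n) = antisymmetrizer q r' n := by
  induction n using Nat.twoStepInduction with
  | zero => exact map_one φ
  | one => exact map_one φ
  | more n _ ih =>
    simp only [antisymmetrizer, map_smul, map_mul, map_sub, map_one, h n (by omega),
      ih fun i hi => h i (by omega)]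

theorem commute_antisymmetrizer (q : K) (r : ℕ → B) (x : B) (n : ℕ)
    (h : ∀ i, i + 1 < n → Commute x (r i)) : Commute x (antisymmetrizer q r n) := by
  induction n using Nat.twoStepInduction with
  | zero => exact Commute.one_right x
  | one => exact Commute.one_right x
  | more n _ ih =>
    have h' := ih fun i hi => h i (by omega)
    exact ((h'.mul_right (((Commute.one_right x).smul_right _).sub_right (h n (by omega)))).mul_right
      h').smul_right _

theorem qInt_one {q : K} (h1 : qInt q 1 ≠ 0) : qInt q 1 = 1 := by
  unfold qInt at *
  rw [pow_one, pow_one] at *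
  exact div_self fun h => h1 (by rw [h, div_zero])

theorem qInt_succ {q : K} (h1 : qInt q 1 ≠ 0) (n : ℕ) :
    qInt q (n + 1) = q ^ n + q⁻¹ * qInt q n := by
  have hd : q - q⁻¹ ≠ 0 := fun h => h1 (by rw [qInt, h, div_zero])
  rw [qInt, qInt, div_eq_iff hd, add_mul, mul_assoc, div_mul_cancel₀ _ hd]
  ring

/-- The inductive step for absorption of the last generator by the antisymmetrizer. -/
theorem generator_mul_antisymmetrizer_step {q c a : K} (hq0 : q ≠ 0) {e f r s : B}
    (hfe : f * e = e) (hee : e * e = e) (hse : s * e = -q⁻¹ • e) (hrf : r * f = f * r)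
    (he : e = c • (f * (a • (1 : B) - s) * f)) (hr : r * r = (q - q⁻¹) • r + 1)
    (hbraid : r * s * r = s * r * s) :
    r * (e * ((c * a * q) • (1 : B) - r) * e) =
      -q⁻¹ • (e * ((c * a * q) • (1 : B) - r) * e) := by
  have hrfe : f * (r * e) = r * e := by rw [← mul_assoc, ← hrf, mul_assoc, hfe]
  have hfsre : c • (f * (s * (r * e))) = (c * a) • (r * e) - e * (r * e) := by
    have : e * (r * e) = c • (a • (f * (f * (r * e))) - f * (s * (f * (r * e)))) := by
      conv_lhs => enter [1]; rw [he]
      simp only [smul_mul_assoc, mul_sub, sub_mul, mul_smul_comm, mul_one, mul_assoc]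
    rw [this, hrfe, hrfe]
    module
  have key : r * (e * (r * e)) = (c * a * q) • (r * e) + (c * a) • e - q⁻¹ • (e * (r * e)) := by
    have h1 : r * (e * (r * e)) = c • (f * ((a • (r * r) - r * s * r) * e)) := by
      conv_lhs => enter [2, 1]; rw [he]
      simp only [smul_mul_assoc, mul_sub, sub_mul, mul_smul_comm, mul_one, mul_assoc]
      rw [hrfe, ← mul_assoc r f, hrf, mul_assoc f r, ← mul_assoc r f (s * _), hrf, mul_assoc f r]
    have h2 : f * (s * r * s * e) = -q⁻¹ • (f * (s * (r * e))) := by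
      rw [mul_assoc _ s e, hse, mul_smul_comm, mul_smul_comm, mul_assoc]
    rw [h1, hr, hbraid, sub_mul, mul_sub, h2, smul_mul_assoc, add_mul, one_mul, mul_smul_comm,
      mul_add, hfe, smul_mul_assoc, mul_smul_comm, hrfe]
    rw [smul_sub, smul_comm c (-q⁻¹), hfsre]
    module
  have h3 : e * ((c * a * q) • (1 : B) - r) * e = (c * a * q) • e - e * (r * e) := by
    rw [mul_sub, sub_mul, mul_smul_comm, mul_one, smul_mul_assoc, hee, mul_assoc e r e]
  have h4 : q⁻¹ * (c * a * q) = c * a := by field_simp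
  rw [h3, mul_sub, mul_smul_comm, key, smul_sub, smul_smul, neg_mul, h4]
  module

variable {M : ℕ} {q : K} {r : ℕ → B}

theorem antisymmetrizer_absorbs (hq0 : q ≠ 0) (hqgen : ∀ n : ℕ, 0 < n → qInt q n ≠ 0)
    (hr : ∀ i, i + 1 < M → r i * r i = (q - q⁻¹) • r i + 1)
    (hbraid : ∀ i, i + 2 < M → r i * r (i + 1) * r i = r (i + 1) * r i * r (i + 1))
    (hfar : ∀ i j, i + 2 ≤ j → j + 1 < M → Commute (r i) (r j)) (n : ℕ) (hn : n + 1 ≤ M) :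
    antisymmetrizer q r n * antisymmetrizer q r (n + 1) = antisymmetrizer q r (n + 1) ∧
      IsIdempotentElem (antisymmetrizer q r (n + 1)) ∧
      ∀ i < n, r i * antisymmetrizer q r (n + 1) = -q⁻¹ • antisymmetrizer q r (n + 1) := by
  induction n with
  | zero => exact ⟨one_mul _, IsIdempotentElem.one, by simp⟩
  | succ n ih =>
    obtain ⟨hfe, hee, hse⟩ := ih (by omega)
    have h1 := hqgen 1 one_pos
    have hn1 := hqgen (n + 1) n.succ_pos
    have hn2 := hqgen (n + 2) (by omega)
    set e := antisymmetrizer q r (n + 1) with he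
    have hp : antisymmetrizer q r (n + 2) = (qInt q (n + 1) / qInt q (n + 2)) •
        (e * ((q ^ (n + 1) / qInt q (n + 1)) • (1 : B) - r n) * e) := rfl
    have hep : e * antisymmetrizer q r (n + 2) = antisymmetrizer q r (n + 2) := by
      rw [hp, mul_smul_comm, ← mul_assoc, ← mul_assoc, hee.eq]
    have hlast : r n * antisymmetrizer q r (n + 2) = -q⁻¹ • antisymmetrizer q r (n + 2) := by
      rw [hp, mul_smul_comm, smul_comm (-q⁻¹)]
      congr 1
      cases n with
      | zero =>
        have he1 : e = 1 := rfl
        have hqq : q⁻¹ * q = 1 := inv_mul_cancel₀ hq0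
        rw [he1, zero_add, qInt_one h1, pow_one, div_one, one_mul, mul_one, mul_sub, mul_smul_comm,
          mul_one, hr 0 (by omega), smul_sub, smul_smul, neg_mul, hqq]
        module
      | succ n =>
        have hn0 := hqgen (n + 1) n.succ_pos
        have hα : q ^ (n + 1 + 1) / qInt q (n + 1 + 1) =
            qInt q (n + 1) / qInt q (n + 2) * (q ^ (n + 1) / qInt q (n + 1)) * q := by
          field_simp
          rw [pow_succ]
        rw [hα]
        refine generator_mul_antisymmetrizer_step (f := antisymmetrizer q r (n + 1)) (s := r n) hq0
          hfe hee.eq (hse n (by omega)) ?_ rfl (hr _ (by omega)) (hbraid n (by omega)).symm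
        exact commute_antisymmetrizer q r _ _ fun i hi => (hfar i _ (by omega) (by omega)).symm
    refine ⟨hep, ?_, fun i hi => ?_⟩
    · have hγ : qInt q (n + 1) / qInt q (n + 2) * (q ^ (n + 1) / qInt q (n + 1) + q⁻¹) = 1 := by
        have := qInt_succ h1 (n + 1)
        rw [div_mul_eq_mul_div, div_eq_one_iff_eq hn2, this, mul_add, mul_div_cancel₀ _ hn1,
          mul_comm q⁻¹]
      have h5 : ((q ^ (n + 1) / qInt q (n + 1)) • (1 : B) - r n) * antisymmetrizer q r (n + 2) =
          (q ^ (n + 1) / qInt q (n + 1) + q⁻¹) • antisymmetrizer q r (n + 2) := by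
        rw [sub_mul, hlast, smul_mul_assoc, one_mul]
        module
      change antisymmetrizer q r (n + 2) * antisymmetrizer q r (n + 2) = _
      conv_lhs => enter [1]; rw [hp]
      rw [smul_mul_assoc, mul_assoc, hep, mul_assoc, h5, mul_smul_comm, hep, smul_smul, hγ,
        one_smul]
    · rcases Nat.lt_succ_iff_lt_or_eq.mp hi with hi | rfl
      · conv_lhs => rw [← hep]
        rw [← mul_assoc, hse i hi, smul_mul_assoc, hep]
      · exact hlast

end Antisymmetrizer

section ReflectionEquation

variable {B : Type*} [Ring B] {M : ℕ} {r s l : ℕ → B}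

theorem Commute.right_of_mul_eq_one {a b x : B} (hab : a * b = 1) (hba : b * a = 1)
    (h : Commute x a) : Commute x b := by
  change x * b = b * x
  calc x * b = b * a * x * b := by rw [hba, one_mul]
    _ = b * (x * a) * b := by rw [h.eq, mul_assoc b]
    _ = b * x := by rw [mul_assoc, mul_assoc, hab, mul_one]

theorem commute_generator_copy
    (hrs : ∀ i, r i * s i = 1) (hsr : ∀ i, s i * r i = 1)
    (hbraid : ∀ i, i + 2 < M → r i * r (i + 1) * r i = r (i + 1) * r i * r (i + 1))
    (hfar : ∀ i j, i + 2 ≤ j → j + 1 < M → Commute (r i) (r j))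
    (h0 : ∀ i, 1 ≤ i → i + 1 < M → Commute (r i) (l 0))
    (hl : ∀ n, l (n + 1) = r n * l n * s n) (n : ℕ) (hn : n < M) :
    (∀ i, n + 1 ≤ i → i + 1 < M → Commute (r i) (l n)) ∧
      ∀ i, i + 2 ≤ n → Commute (r i) (l n) := by
  induction n using Nat.strong_induction_on with
  | _ n ih =>
    cases n with
    | zero => exact ⟨h0, by omega⟩
    | succ n =>
      obtain ⟨hgt, hlt⟩ := ih n (by omega) (by omega)
      refine ⟨fun i hi hiM => ?_, fun i hi => ?_⟩
      · have h := (hfar n i (by omega) hiM).symm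
        rw [hl]
        exact (h.mul_right (hgt i (by omega) hiM)).mul_right
          (h.right_of_mul_eq_one (hrs n) (hsr n))
      · by_cases hin : i + 2 ≤ n
        · have h := hfar i n hin hn
          rw [hl]
          exact (h.mul_right (hlt i hin)).mul_right (h.right_of_mul_eq_one (hrs n) (hsr n))
        · obtain rfl : n = i + 1 := by omega
          have hc : Commute (r (i + 1)) (l i) := (ih i (by omega) (by omega)).1 _ le_rfl hn
          have hb := hbraid i (by omega)
          have hb' : r (i + 1) * (s i * s (i + 1)) = s i * s (i + 1) * r i := by
            calc r (i + 1) * (s i * s (i + 1))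
                = s i * (s (i + 1) * (r (i + 1) * r i * r (i + 1))) * s i * s (i + 1) := by
                  simp only [mul_assoc]
                  rw [← mul_assoc (s (i + 1)) (r (i + 1)), hsr, one_mul, ← mul_assoc (s i) (r i),
                    hsr, one_mul]
              _ = s i * s (i + 1) * r i := by
                  rw [← hb]
                  simp only [mul_assoc]
                  rw [← mul_assoc (r i) (s i) (s (i + 1)), hrs, one_mul, hrs, mul_one]
          have h2 : l (i + 1 + 1) = r (i + 1) * r i * l i * (s i * s (i + 1)) := by
            rw [hl, hl]
            simp only [mul_assoc]
          change r i * l (i + 1 + 1) = l (i + 1 + 1) * r i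
          rw [h2]
          calc r i * (r (i + 1) * r i * l i * (s i * s (i + 1)))
              = r i * r (i + 1) * r i * l i * (s i * s (i + 1)) := by simp only [mul_assoc]
            _ = r (i + 1) * r i * (r (i + 1) * l i) * (s i * s (i + 1)) := by
                rw [hb]; simp only [mul_assoc]
            _ = r (i + 1) * r i * l i * (r (i + 1) * (s i * s (i + 1))) := by
                rw [hc.eq]; simp only [mul_assoc]
            _ = _ := by rw [hb']; simp only [mul_assoc]

theorem reflection_equation_copy
    (hrs : ∀ i, r i * s i = 1) (hsr : ∀ i, s i * r i = 1)
    (hbraid : ∀ i, i + 2 < M → r i * r (i + 1) * r i = r (i + 1) * r i * r (i + 1))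
    (hfar : ∀ i j, i + 2 ≤ j → j + 1 < M → Commute (r i) (r j))
    (h0 : ∀ i, 1 ≤ i → i + 1 < M → Commute (r i) (l 0))
    (hl : ∀ n, l (n + 1) = r n * l n * s n)
    (hRE : 1 < M → r 0 * l 0 * r 0 * l 0 = l 0 * r 0 * l 0 * r 0) (n : ℕ) (hn : n + 1 < M) :
    r n * l n * r n * l n = l n * r n * l n * r n := by
  induction n with
  | zero => exact hRE hn
  | succ n ih =>
    have hRE' := ih (by omega)
    have hb := hbraid n (by omega)
    have hc : Commute (r (n + 1)) (l n) :=
      (commute_generator_copy hrs hsr hbraid hfar h0 hl n (by omega)).1 _ le_rfl hn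
    set g := r n * r (n + 1)
    set g' := s (n + 1) * s n
    have hgg : g' * g = 1 := by
      simp only [g, g', mul_assoc]
      rw [← mul_assoc (s n), hsr, one_mul, hsr]
    have hgg' : g * g' = 1 := by
      simp only [g, g', mul_assoc]
      rw [← mul_assoc (r (n + 1)), hrs, one_mul, hrs]
    have hrg : r (n + 1) = g * r n * g' := by
      rw [hb, mul_assoc, mul_assoc, ← mul_assoc (r n), hgg', mul_one]
    have hlg : l (n + 1) = g * l n * g' := by
      simp only [hl, g, g', mul_assoc]
      rw [← mul_assoc (r (n + 1)) (l n), hc.eq, mul_assoc (l n), ← mul_assoc (r (n + 1)), hrs,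
        one_mul]
    have hconj (x y : B) : g * x * g' * (g * y * g') = g * (x * y) * g' := by
      simp only [mul_assoc]
      rw [← mul_assoc g' g, hgg, one_mul]
    rw [hrg, hlg]
    simp only [hconj, hRE']

theorem commute_generator_prod_copies
    (hrs : ∀ i, r i * s i = 1) (hsr : ∀ i, s i * r i = 1)
    (hbraid : ∀ i, i + 2 < M → r i * r (i + 1) * r i = r (i + 1) * r i * r (i + 1))
    (hfar : ∀ i j, i + 2 ≤ j → j + 1 < M → Commute (r i) (r j))
    (h0 : ∀ i, 1 ≤ i → i + 1 < M → Commute (r i) (l 0))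
    (hl : ∀ n, l (n + 1) = r n * l n * s n)
    (hRE : 1 < M → r 0 * l 0 * r 0 * l 0 = l 0 * r 0 * l 0 * r 0) (i : ℕ) (hi : i + 1 < M) :
    Commute (r i) ((List.range M).map l).prod := by
  have hcopy := commute_generator_copy hrs hsr hbraid hfar h0 hl
  have hpair : Commute (r i) (l i * l (i + 1)) := by
    have h := reflection_equation_copy hrs hsr hbraid hfar h0 hl hRE i hi
    change r i * (l i * l (i + 1)) = l i * l (i + 1) * r i
    rw [hl]
    simp only [← mul_assoc]
    rw [h, mul_assoc (l i * r i * l i), hrs, mul_one, mul_assoc (l i * r i * l i), hsr, mul_one]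
  have hlow (n : ℕ) (hn : n ≤ i) : Commute (r i) ((List.range n).map l).prod := by
    refine Commute.list_prod_right _ _ fun x hx => ?_
    obtain ⟨j, hj, rfl⟩ := List.mem_map.mp hx
    have := List.mem_range.mp hj
    exact (hcopy j (by omega)).1 i (by omega) hi
  have hprod (n : ℕ) : ((List.range (n + 1)).map l).prod = ((List.range n).map l).prod * l n := by
    rw [List.range_succ, List.map_append, List.prod_append, List.map_singleton,
      List.prod_singleton]
  have hhigh (n : ℕ) (hn : i + 2 + n ≤ M) :
      Commute (r i) ((List.range (i + 2 + n)).map l).prod := by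
    induction n with
    | zero =>
      rw [add_zero, hprod, hprod, mul_assoc]
      exact (hlow i le_rfl).mul_right hpair
    | succ n ih =>
      rw [← add_assoc, hprod]
      exact (ih (by omega)).mul_right ((hcopy _ (by omega)).2 i (by omega))
  obtain ⟨n, rfl⟩ := Nat.exists_eq_add_of_le (show i + 2 ≤ M by omega)
  exact hhigh n le_rfl

end ReflectionEquation

section SiteLift

variable {k l p N : ℕ} {A : Type*} [Ring A]

/-- The matrix `M` acting on the tensor factors selected by `e`, and trivially on all others. -/
def siteLift (e : Fin k ↪ Fin l) (M : Matrix (Fin k → Fin N) (Fin k → Fin N) A) :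
    Matrix (Fin l → Fin N) (Fin l → Fin N) A :=
  Matrix.of fun f g =>
    M (f ∘ e) (g ∘ e) * if ∀ t, t ∉ Set.range e → f t = g t then 1 else 0

theorem sum_extend (e : Fin k ↪ Fin l) (f : Fin l → Fin N) (F : (Fin l → Fin N) → A)
    (hF : ∀ h, (¬ ∀ t, t ∉ Set.range e → f t = h t) → F h = 0) :
    ∑ h, F h = ∑ a : Fin k → Fin N, F (Function.extend e a f) := by
  symm
  refine Finset.sum_of_injOn (fun a => Function.extend e a f) ?_ (by simp) ?_ (by simp)
  · intro a _ b _ hab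
    funext t
    simpa [e.injective.extend_apply] using congrFun hab (e t)
  · intro h _ hh
    refine hF h fun hfh => hh ⟨h ∘ e, by simp, ?_⟩
    funext t
    by_cases ht : ∃ s, e s = t
    · obtain ⟨s, rfl⟩ := ht
      exact e.injective.extend_apply _ _ s
    · exact (Function.extend_apply' _ _ _ ht).trans (hfh t ht)

theorem extend_comp_embedding (e : Fin k ↪ Fin l) (a : Fin k → Fin N) (f : Fin l → Fin N) :
    Function.extend e a f ∘ e = a :=
  funext fun s => e.injective.extend_apply _ _ s

theorem extend_of_notMem (e : Fin k ↪ Fin l) (a : Fin k → Fin N) (f : Fin l → Fin N) {t : Fin l}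
    (ht : t ∉ Set.range e) : Function.extend e a f t = f t :=
  Function.extend_apply' _ _ _ ht

theorem siteLift_mul_apply (e : Fin k ↪ Fin l) (M : Matrix (Fin k → Fin N) (Fin k → Fin N) A)
    (X : Matrix (Fin l → Fin N) (Fin l → Fin N) A) (f g : Fin l → Fin N) :
    (siteLift e M * X) f g = ∑ a, M (f ∘ e) a * X (Function.extend e a f) g := by
  rw [Matrix.mul_apply, sum_extend e f]
  · refine Finset.sum_congr rfl fun a _ => ?_
    rw [siteLift, Matrix.of_apply, extend_comp_embedding,
      if_pos fun t ht => (extend_of_notMem e a f ht).symm, mul_one]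
  · intro h hh
    rw [siteLift, Matrix.of_apply, if_neg hh, mul_zero, zero_mul]

theorem mul_siteLift_apply (e : Fin k ↪ Fin l) (M : Matrix (Fin k → Fin N) (Fin k → Fin N) A)
    (X : Matrix (Fin l → Fin N) (Fin l → Fin N) A) (f g : Fin l → Fin N) :
    (X * siteLift e M) f g = ∑ a, X f (Function.extend e a g) * M a (g ∘ e) := by
  rw [Matrix.mul_apply, sum_extend e g]
  · refine Finset.sum_congr rfl fun a _ => ?_
    rw [siteLift, Matrix.of_apply, extend_comp_embedding,
      if_pos fun t ht => extend_of_notMem e a g ht, mul_one]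
  · intro h hh
    rw [siteLift, Matrix.of_apply, if_neg fun h' => hh fun t ht => (h' t ht).symm, mul_zero,
      mul_zero]

theorem siteLift_mul (e : Fin k ↪ Fin l) (M M' : Matrix (Fin k → Fin N) (Fin k → Fin N) A) :
    siteLift e (M * M') = siteLift e M * siteLift e M' := by
  ext f g
  rw [siteLift_mul_apply, siteLift, Matrix.of_apply, Matrix.mul_apply, Finset.sum_mul]
  refine Finset.sum_congr rfl fun a _ => ?_
  rw [siteLift, Matrix.of_apply, extend_comp_embedding, mul_assoc]
  congr 2
  refine if_congr (forall₂_congr fun t ht => ?_) rfl rfl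
  rw [extend_of_notMem e a f ht]

theorem siteLift_one (e : Fin k ↪ Fin l) :
    siteLift e (1 : Matrix (Fin k → Fin N) (Fin k → Fin N) A) = 1 := by
  ext f g
  rw [siteLift, Matrix.of_apply, Matrix.one_apply, Matrix.one_apply, ite_mul, one_mul, zero_mul,
    ← ite_and]
  refine if_congr ⟨fun ⟨h₁, h₂⟩ => ?_, fun h => by simp [h]⟩ rfl rfl
  funext t
  by_cases ht : t ∈ Set.range e
  · obtain ⟨s, rfl⟩ := ht
    exact congrFun h₁ s
  · exact h₂ t ht

/-- `siteLift` as a homomorphism of algebras. -/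
def siteHom (e : Fin k ↪ Fin l) [Algebra K A] :
    Matrix (Fin k → Fin N) (Fin k → Fin N) A →ₐ[K] Matrix (Fin l → Fin N) (Fin l → Fin N) A :=
  AlgHom.ofLinearMap
    { toFun := siteLift e
      map_add' := fun M M' => by
        ext f g
        simp only [siteLift, Matrix.of_apply, Matrix.add_apply, add_mul]
      map_smul' := fun c M => by ext f g; simp [siteLift] }
    (siteLift_one e) (siteLift_mul e)

theorem siteHom_apply (e : Fin k ↪ Fin l) [Algebra K A]
    (M : Matrix (Fin k → Fin N) (Fin k → Fin N) A) : siteHom (K := K) e M = siteLift e M :=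
  rfl

theorem siteLift_siteLift (e : Fin k ↪ Fin l) (e' : Fin l ↪ Fin p)
    (M : Matrix (Fin k → Fin N) (Fin k → Fin N) A) :
    siteLift e' (siteLift e M) = siteLift (e.trans e') M := by
  ext f g
  simp only [siteLift, Matrix.of_apply, mul_assoc, ite_mul, one_mul, zero_mul, ← ite_and]
  congr 1
  refine if_congr ⟨fun ⟨h₁, h₂⟩ t ht => ?_, fun h => ⟨fun t ht => ?_, fun t ht => ?_⟩⟩ rfl rfl
  · by_cases h : t ∈ Set.range e'
    · obtain ⟨s, rfl⟩ := h
      exact h₁ s fun ⟨u, hu⟩ => ht ⟨u, by simp [hu]⟩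
    · exact h₂ t h
  · exact h _ fun ⟨u, hu⟩ => ht ⟨u, e'.injective hu⟩
  · exact h _ fun ⟨u, hu⟩ => ht ⟨e u, hu⟩

theorem commute_siteLift (e : Fin k ↪ Fin p) (e' : Fin l ↪ Fin p)
    (hdisj : Disjoint (Set.range e) (Set.range e'))
    (M : Matrix (Fin k → Fin N) (Fin k → Fin N) A) (M' : Matrix (Fin l → Fin N) (Fin l → Fin N) A)
    (hM : ∀ a b c d, Commute (M a b) (M' c d)) :
    Commute (siteLift e M) (siteLift e' M') := by
  have key {k l : ℕ} (e : Fin k ↪ Fin p) (e' : Fin l ↪ Fin p)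
      (hdisj : Disjoint (Set.range e) (Set.range e'))
      (M : Matrix (Fin k → Fin N) (Fin k → Fin N) A)
      (M' : Matrix (Fin l → Fin N) (Fin l → Fin N) A) (f g : Fin p → Fin N) :
      (siteLift e M * siteLift e' M') f g = M (f ∘ e) (g ∘ e) * M' (f ∘ e') (g ∘ e') *
        if ∀ t, t ∉ Set.range e ∪ Set.range e' → f t = g t then 1 else 0 := by
    rw [siteLift_mul_apply, Finset.sum_eq_single (g ∘ e)]
    · have hfe : Function.extend e (g ∘ e) f ∘ e' = f ∘ e' := funext fun t =>
        extend_of_notMem e _ _ (Set.disjoint_right.mp hdisj ⟨t, rfl⟩)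
      rw [siteLift, Matrix.of_apply, hfe, mul_assoc]
      congr 2
      refine if_congr ⟨fun h t ht => ?_, fun h t ht => ?_⟩ rfl rfl
      · rw [← h t fun h' => ht (Or.inr h'), extend_of_notMem e _ _ fun h' => ht (Or.inl h')]
      · by_cases h' : t ∈ Set.range e
        · obtain ⟨s, rfl⟩ := h'
          exact e.injective.extend_apply _ _ s
        · rw [extend_of_notMem e _ _ h', h t (not_or.mpr ⟨h', ht⟩)]
    · intro a _ ha
      rw [siteLift, Matrix.of_apply, if_neg, mul_zero, mul_zero]
      refine fun h => ha (funext fun s => ?_)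
      rw [Function.comp_apply, ← h (e s) (Set.disjoint_left.mp hdisj ⟨s, rfl⟩),
        e.injective.extend_apply]
    · exact fun h => absurd (Finset.mem_univ _) h
  refine Matrix.ext fun f g => ?_
  rw [key e e' hdisj, key e' e hdisj.symm, (hM _ _ _ _).eq]
  congr 1
  exact if_congr (by rw [Set.union_comm]) rfl rfl

end SiteLift

section Window

variable {k l N : ℕ} {A : Type*} [Ring A]

/-- The embedding of `w` consecutive tensor factors starting at position `i`. -/
def window (i w l : ℕ) (h : i + w ≤ l) : Fin w ↪ Fin l where
  toFun t := ⟨i + t, by omega⟩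
  inj' a b hab := by
    have := congrArg Fin.val hab
    exact Fin.ext (by simpa using this)

theorem mem_range_window {i w l : ℕ} {h : i + w ≤ l} {t : Fin l} :
    t ∈ Set.range (window i w l h) ↔ i ≤ t ∧ (t : ℕ) < i + w := by
  refine ⟨?_, fun ht => ⟨⟨t - i, by omega⟩, Fin.ext ?_⟩⟩
  · rintro ⟨s, rfl⟩
    exact ⟨Nat.le_add_right _ _, Nat.add_lt_add_left s.2 i⟩
  · exact Nat.add_sub_cancel' ht.1

theorem disjoint_range_window {i w j v l : ℕ} {h : i + w ≤ l} {h' : j + v ≤ l} (hij : i + w ≤ j) :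
    Disjoint (Set.range (window i w l h)) (Set.range (window j v l h')) :=
  Set.disjoint_left.mpr fun _ ht ht' => by
    have := mem_range_window.mp ht
    have := mem_range_window.mp ht'
    omega

theorem window_trans_window {i w j v l : ℕ} (h : i + w ≤ v) (h' : j + v ≤ l) :
    (window i w v h).trans (window j v l h') = window (j + i) w l (by omega) :=
  Function.Embedding.ext fun t => Fin.ext (Nat.add_assoc j i t).symm

/-- A matrix indexed by pairs, viewed as a matrix on two tensor factors. -/
def onPair (M : Matrix (Fin N × Fin N) (Fin N × Fin N) A) :
    Matrix (Fin 2 → Fin N) (Fin 2 → Fin N) A :=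
  M.submatrix (finTwoArrowEquiv _) (finTwoArrowEquiv _)

theorem onPair_mul (M M' : Matrix (Fin N × Fin N) (Fin N × Fin N) A) :
    onPair (M * M') = onPair M * onPair M' :=
  (Matrix.submatrix_mul_equiv _ _ _ _ _).symm

theorem onPair_one : onPair (1 : Matrix (Fin N × Fin N) (Fin N × Fin N) A) = 1 :=
  Matrix.submatrix_one_equiv _

theorem liftPos_eq_siteLift (R : Matrix (Fin N × Fin N) (Fin N × Fin N) K) {i : ℕ}
    (h : i + 2 ≤ k) : liftPos k N R i = siteLift (window i 2 k h) (onPair R) := by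
  ext f g
  rw [liftPos, dif_pos (show i + 1 < k from h), siteLift, Matrix.of_apply, Matrix.of_apply,
    Finset.prod_ite_zero, Finset.prod_const_one]
  have H : (∀ t ∈ Finset.univ.filter (fun t : Fin k => (t : ℕ) ≠ i ∧ (t : ℕ) ≠ i + 1),
      f t = g t) ↔ ∀ t, t ∉ Set.range (window i 2 k h) → f t = g t := by
    refine forall_congr' fun t => ?_
    rw [mem_range_window, Finset.mem_filter]
    refine ⟨fun H ht => H ⟨Finset.mem_univ _, ?_⟩, fun H ht => H ?_⟩ <;> omega
  by_cases hfg : ∀ t, t ∉ Set.range (window i 2 k h) → f t = g t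
  · rw [if_pos hfg, if_pos (H.mpr hfg)]
    rfl
  · rw [if_neg hfg, if_neg (mt H.mp hfg), mul_zero, mul_zero]

theorem siteLift_window_liftPos (R : Matrix (Fin N × Fin N) (Fin N × Fin N) K) {i j : ℕ}
    (h : i + 2 ≤ k) (h' : j + k ≤ l) :
    siteLift (window j k l h') (liftPos k N R i) = liftPos l N R (j + i) := by
  rw [liftPos_eq_siteLift R h, siteLift_siteLift, window_trans_window,
    liftPos_eq_siteLift R (by omega)]

theorem liftPos_braid {R : Matrix (Fin N × Fin N) (Fin N × Fin N) K}
    (hbraid : liftPos 3 N R 0 * liftPos 3 N R 1 * liftPos 3 N R 0 =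
      liftPos 3 N R 1 * liftPos 3 N R 0 * liftPos 3 N R 1) (i : ℕ) (hi : i + 2 < k) :
    liftPos k N R i * liftPos k N R (i + 1) * liftPos k N R i =
      liftPos k N R (i + 1) * liftPos k N R i * liftPos k N R (i + 1) := by
  have h := congrArg (siteLift (window i 3 k hi)) hbraid
  simpa only [siteLift_mul, siteLift_window_liftPos R (show 0 + 2 ≤ 3 by omega) hi,
    siteLift_window_liftPos R (show 1 + 2 ≤ 3 by omega) hi, add_zero] using h

theorem liftPos_commute (R : Matrix (Fin N × Fin N) (Fin N × Fin N) K) (i j : ℕ)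
    (hij : i + 2 ≤ j) (hj : j + 1 < k) : Commute (liftPos k N R i) (liftPos k N R j) := by
  rw [liftPos_eq_siteLift R (show i + 2 ≤ k by omega), liftPos_eq_siteLift R hj]
  exact commute_siteLift _ _ (disjoint_range_window hij) _ _ fun _ _ _ _ => Commute.all _ _

theorem liftPos_hecke {R : Matrix (Fin N × Fin N) (Fin N × Fin N) K} {q : K}
    (hHecke : R * R = (q - q⁻¹) • R + 1) (i : ℕ) (hi : i + 1 < k) :
    liftPos k N R i * liftPos k N R i = (q - q⁻¹) • liftPos k N R i + 1 := by
  have h2 : onPair R * onPair R = (q - q⁻¹) • onPair R + 1 := by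
    rw [← onPair_mul, hHecke, ← onPair_one]
    rfl
  rw [liftPos_eq_siteLift R hi, ← siteHom_apply (K := K), ← map_mul, h2, map_add, map_smul, map_one]

theorem liftPos_mul_inverse {R S : Matrix (Fin N × Fin N) (Fin N × Fin N) K} (hRS : R * S = 1)
    (i : ℕ) : liftPos k N R i * liftPos k N S i = 1 := by
  by_cases hi : i + 2 ≤ k
  · rw [liftPos_eq_siteLift R hi, liftPos_eq_siteLift S hi, ← siteLift_mul, ← onPair_mul, hRS,
      onPair_one, siteLift_one]
  · simp only [liftPos, dif_neg (show ¬ i + 1 < k from hi), mul_one]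

theorem siteLift_map {A' : Type*} [Ring A'] (φ : A →+* A') (e : Fin k ↪ Fin l)
    (M : Matrix (Fin k → Fin N) (Fin k → Fin N) A) :
    (siteLift e M).map φ = siteLift e (M.map φ) := by
  ext f g
  simp only [siteLift, Matrix.map_apply, Matrix.of_apply, map_mul, apply_ite φ, map_one, map_zero]

theorem embed1_eq_siteLift (hk : 0 < k) (L : Matrix (Fin N) (Fin N) A) :
    embed1 k N hk L =
      siteLift (window 0 1 k (by omega)) (L.submatrix (fun f => f 0) (fun f => f 0)) := by
  ext f g
  rw [embed1, siteLift, Matrix.of_apply, Matrix.of_apply]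
  congr 1
  refine if_congr (forall_congr' fun t => ?_) rfl rfl
  rw [mem_range_window]
  refine ⟨fun H ht => H ?_, fun H ht => H ?_⟩ <;> omega

theorem embed1_two (L : Matrix (Fin N) (Fin N) A) :
    embed1 2 N two_pos L = onPair (Matrix.of (fun p p' : Fin N × Fin N =>
      L p.1 p'.1 * (if p.2 = p'.2 then 1 else 0))) := by
  ext f g
  simp [embed1, onPair, finTwoArrowEquiv, Fin.forall_fin_two]

theorem siteLift_window_embed1 (hk : 0 < k) (h : 0 + k ≤ l) (L : Matrix (Fin N) (Fin N) A) :
    siteLift (window 0 k l h) (embed1 k N hk L) = embed1 l N (by omega) L := by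
  rw [embed1_eq_siteLift, siteLift_siteLift, window_trans_window, embed1_eq_siteLift]

theorem siteLift_window_skewSym (R : Matrix (Fin N × Fin N) (Fin N × Fin N) K) (q : K)
    (h : 0 + k ≤ l) {n : ℕ} (hn : n ≤ k) :
    siteLift (window 0 k l h) (skewSym k N q R n) = skewSym l N q R n := by
  rw [skewSym_eq_antisymmetrizer, skewSym_eq_antisymmetrizer, ← siteHom_apply (K := K)]
  refine map_antisymmetrizer _ _ _ _ _ fun i hi => ?_
  rw [siteHom_apply, siteLift_window_liftPos R (by omega), zero_add]

end Window

section QuantumTrace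

variable {k N : ℕ}

/-- The trace over the last tensor factor, weighted by `C`. -/
def lastTrace (C : Matrix (Fin N) (Fin N) K)
    (X : Matrix (Fin (k + 1) → Fin N) (Fin (k + 1) → Fin N) K) :
    Matrix (Fin k → Fin N) (Fin k → Fin N) K :=
  Matrix.of fun f g => ∑ a, ∑ b, X (Fin.snoc f a) (Fin.snoc g b) * C b a

/-- The quantum trace over all tensor factors. -/
def quantumTrace (C : Matrix (Fin N) (Fin N) K)
    (X : Matrix (Fin k → Fin N) (Fin k → Fin N) K) : K :=
  ∑ I, ∑ J, X I J * ∏ t, C (J t) (I t)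

theorem extend_window_snoc (h : 0 + k ≤ k + 1) (a f : Fin k → Fin N) (x : Fin N) :
    Function.extend (window 0 k (k + 1) h) a (Fin.snoc f x) = Fin.snoc (α := fun _ => Fin N) a x := by
  funext t
  refine Fin.lastCases ?_ (fun s => ?_) t
  · rw [extend_of_notMem, Fin.snoc_last, Fin.snoc_last]
    rw [mem_range_window]
    simp
  · have hs : s.castSucc = window 0 k (k + 1) h s := Fin.ext (zero_add _).symm
    rw [Fin.snoc_castSucc, hs, (window 0 k (k + 1) h).injective.extend_apply]

theorem snoc_comp_window (h : 0 + k ≤ k + 1) (f : Fin k → Fin N) (x : Fin N) :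
    (Fin.snoc f x : Fin (k + 1) → Fin N) ∘ window 0 k (k + 1) h = f := by
  funext s
  have hs : s.castSucc = window 0 k (k + 1) h s := Fin.ext (zero_add _).symm
  rw [Function.comp_apply, ← hs, Fin.snoc_castSucc]

variable (C : Matrix (Fin N) (Fin N) K)

theorem lastTrace_siteLift_mul (h : 0 + k ≤ k + 1) (Y : Matrix (Fin k → Fin N) (Fin k → Fin N) K)
    (X : Matrix (Fin (k + 1) → Fin N) (Fin (k + 1) → Fin N) K) :
    lastTrace C (siteLift (window 0 k (k + 1) h) Y * X) = Y * lastTrace C X := by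
  ext f g
  rw [Matrix.mul_apply]
  simp only [lastTrace, Matrix.of_apply, siteLift_mul_apply,
    snoc_comp_window, extend_window_snoc, Finset.sum_mul, Finset.mul_sum, mul_assoc]
  exact (Finset.sum_congr rfl fun a _ => Finset.sum_comm).trans Finset.sum_comm

theorem lastTrace_mul_siteLift (h : 0 + k ≤ k + 1) (Y : Matrix (Fin k → Fin N) (Fin k → Fin N) K)
    (X : Matrix (Fin (k + 1) → Fin N) (Fin (k + 1) → Fin N) K) :
    lastTrace C (X * siteLift (window 0 k (k + 1) h) Y) = lastTrace C X * Y := by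
  ext f g
  rw [Matrix.mul_apply]
  simp only [lastTrace, Matrix.of_apply, mul_siteLift_apply,
    snoc_comp_window, extend_window_snoc, Finset.sum_mul]
  refine ((Finset.sum_congr rfl fun a _ => Finset.sum_comm).trans Finset.sum_comm).trans ?_
  simp only [mul_right_comm]

theorem lastTrace_sub (X Y : Matrix (Fin (k + 1) → Fin N) (Fin (k + 1) → Fin N) K) :
    lastTrace C (X - Y) = lastTrace C X - lastTrace C Y := by
  ext f g
  simp only [lastTrace, Matrix.of_apply, Matrix.sub_apply, sub_mul, Finset.sum_sub_distrib]

theorem lastTrace_smul (c : K) (X : Matrix (Fin (k + 1) → Fin N) (Fin (k + 1) → Fin N) K) :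
    lastTrace C (c • X) = c • lastTrace C X := by
  ext f g
  simp only [lastTrace, Matrix.of_apply, Matrix.smul_apply, smul_mul_assoc, Finset.smul_sum]

theorem lastTrace_one :
    lastTrace C (1 : Matrix (Fin (k + 1) → Fin N) (Fin (k + 1) → Fin N) K) = C.trace • 1 := by
  ext f g
  simp only [lastTrace, Matrix.of_apply, Matrix.one_apply, Matrix.smul_apply, Matrix.trace,
    Matrix.diag_apply, Fin.snoc_inj, ite_and, ite_mul, one_mul, zero_mul]
  by_cases hfg : f = g <;> simp [hfg]

theorem quantumTrace_lastTrace (X : Matrix (Fin (k + 1) → Fin N) (Fin (k + 1) → Fin N) K) :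
    quantumTrace C (lastTrace C X) = quantumTrace C X := by
  have hsum (F : (Fin (k + 1) → Fin N) → K) :
      ∑ I, F I = ∑ I : Fin k → Fin N, ∑ a : Fin N, F (Fin.snoc I a) := by
    rw [← (Fin.snocEquiv fun _ : Fin (k + 1) => Fin N).sum_comp, Fintype.sum_prod_type_right]
    rfl
  simp only [quantumTrace, lastTrace, Matrix.of_apply, hsum, Finset.sum_mul,
    Fin.prod_univ_castSucc, Fin.snoc_castSucc, Fin.snoc_last]
  refine Finset.sum_congr rfl fun I _ => Finset.sum_comm.trans ?_
  simp only [mul_assoc, mul_comm (C _ _)]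

theorem quantumTrace_smul (c : K) (X : Matrix (Fin k → Fin N) (Fin k → Fin N) K) :
    quantumTrace C (c • X) = c * quantumTrace C X := by
  simp only [quantumTrace, Matrix.smul_apply, smul_eq_mul, mul_assoc, Finset.mul_sum]

theorem lastTrace_liftPos {R : Matrix (Fin N × Fin N) (Fin N × Fin N) K}
    (hRC : ∀ i k, ∑ j, ∑ l, R (i, j) (k, l) * C l j = if i = k then 1 else 0) :
    lastTrace C (liftPos (k + 2) N R k) = 1 := by
  ext f g
  have hf (f : Fin (k + 1) → Fin N) (a : Fin N) :
      finTwoArrowEquiv _ ((Fin.snoc f a : Fin (k + 2) → Fin N) ∘ window k 2 (k + 2) le_rfl) =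
        (f (Fin.last k), a) := by
    have h0 : window k 2 (k + 2) le_rfl 0 = (Fin.last k).castSucc := rfl
    have h1 : window k 2 (k + 2) le_rfl 1 = Fin.last (k + 1) := rfl
    simp [finTwoArrowEquiv, h0, h1]
  have hc (a b : Fin N) : (∀ t, t ∉ Set.range (window k 2 (k + 2) le_rfl) →
      (Fin.snoc f a : Fin (k + 2) → Fin N) t = (Fin.snoc g b : Fin (k + 2) → Fin N) t) ↔
      ∀ t : Fin k, f t.castSucc = g t.castSucc := by
    refine ⟨fun H t => ?_, fun H t ht => ?_⟩
    · have h := H t.castSucc.castSucc (by rw [mem_range_window]; simp)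
      rwa [Fin.snoc_castSucc, Fin.snoc_castSucc] at h
    · rw [mem_range_window] at ht
      have hs : t = (⟨t, by omega⟩ : Fin k).castSucc.castSucc := rfl
      rw [hs, Fin.snoc_castSucc, Fin.snoc_castSucc, H]
  have hfg : f = g ↔ f (Fin.last k) = g (Fin.last k) ∧ ∀ t : Fin k, f t.castSucc = g t.castSucc :=
    funext_iff.trans (by rw [Fin.forall_fin_succ', and_comm])
  rw [liftPos_eq_siteLift R le_rfl]
  simp only [lastTrace, siteLift, Matrix.of_apply, onPair, Matrix.submatrix_apply, hf, hc,
    mul_right_comm _ (ite _ _ _), ← Finset.sum_mul, hRC, Matrix.one_apply, hfg]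
  rw [ite_and, ite_mul, one_mul, zero_mul]

end QuantumTrace

theorem Matrix.exists_eq_mul_of_rank_eq_one {ι : Type*} [Fintype ι] [DecidableEq ι]
    {P : Matrix ι ι K} (h : P.rank = 1) : ∃ u v : ι → K, ∀ i j, P i j = u i * v j := by
  obtain ⟨u, -, hu⟩ := finrank_eq_one_iff'.mp h
  choose v hv using fun j => hu ⟨P *ᵥ Pi.single j 1, LinearMap.mem_range_self P.mulVecLin _⟩
  refine ⟨u.1, v, fun i j => ?_⟩
  have := congrFun (congrArg Subtype.val (hv j)) i
  simpa [mul_comm] using this.symm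

theorem Matrix.exists_sandwich_eq_mul {ι A : Type*} [Fintype ι] [DecidableEq ι] [Ring A]
    [Algebra K A] {P : Matrix ι ι K} (h : P.rank = 1) (X : Matrix ι ι A) :
    ∃ s : A, ∀ i j, (P.map (algebraMap K A) * X * P.map (algebraMap K A)) i j =
      s * algebraMap K A (P i j) := by
  obtain ⟨u, v, huv⟩ := Matrix.exists_eq_mul_of_rank_eq_one h
  refine ⟨∑ b, (∑ a, algebraMap K A (v a) * X a b) * algebraMap K A (u b), fun i j => ?_⟩
  simp only [Matrix.mul_apply, Matrix.map_apply, huv, map_mul, Finset.sum_mul]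
  refine Finset.sum_congr rfl fun b _ => Finset.sum_congr rfl fun a _ => ?_
  simp only [mul_assoc]
  rw [Algebra.commutes (u i)]
  simp only [mul_assoc, ← map_mul, mul_comm (v j)]

section QuantumDimension

variable {m N : ℕ} {R : Matrix (Fin N × Fin N) (Fin N × Fin N) K} {q : K}
  {C : Matrix (Fin N) (Fin N) K}

theorem skewSym_idempotent (hq0 : q ≠ 0) (hqgen : ∀ n : ℕ, 0 < n → qInt q n ≠ 0)
    (hbraid : liftPos 3 N R 0 * liftPos 3 N R 1 * liftPos 3 N R 0 =
      liftPos 3 N R 1 * liftPos 3 N R 0 * liftPos 3 N R 1)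
    (hHecke : R * R = (q - q⁻¹) • R + 1) (n : ℕ) :
    IsIdempotentElem (skewSym (n + 1) N q R (n + 1)) := by
  rw [skewSym_eq_antisymmetrizer]
  exact (antisymmetrizer_absorbs hq0 hqgen (liftPos_hecke hHecke) (liftPos_braid hbraid)
    (liftPos_commute R) n le_rfl).2.1

theorem lastTrace_skewSym
    (hRC : ∀ i k, ∑ j, ∑ l, R (i, j) (k, l) * C l j = if i = k then 1 else 0) {n : ℕ}
    (hn : qInt q (n + 1) ≠ 0) (hP : IsIdempotentElem (skewSym (n + 1) N q R (n + 1))) :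
    lastTrace C (skewSym (n + 2) N q R (n + 2)) =
      ((q ^ (n + 1) * C.trace - qInt q (n + 1)) / qInt q (n + 2)) •
        skewSym (n + 1) N q R (n + 1) := by
  have h : 0 + (n + 1) ≤ n + 1 + 1 := by omega
  rw [skewSym, ← siteLift_window_skewSym R q h le_rfl, lastTrace_smul, lastTrace_mul_siteLift,
    lastTrace_siteLift_mul, lastTrace_sub, lastTrace_smul, lastTrace_one, lastTrace_liftPos C hRC,
    smul_smul, mul_sub, sub_mul, mul_smul_comm, mul_one, smul_mul_assoc, hP.eq]
  have hs : (qInt q (n + 1) / qInt q (n + 2)) * (q ^ (n + 1) / qInt q (n + 1) * C.trace - 1) =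
      (q ^ (n + 1) * C.trace - qInt q (n + 1)) / qInt q (n + 2) := by
    field_simp
  rw [← hs]
  module

theorem pow_mul_trace_eq_qInt (hm : 0 < m) (hqgen : ∀ n : ℕ, 0 < n → qInt q n ≠ 0)
    (hRC : ∀ i k, ∑ j, ∑ l, R (i, j) (k, l) * C l j = if i = k then 1 else 0)
    (hP : ∀ n, IsIdempotentElem (skewSym (n + 1) N q R (n + 1)))
    (hne : skewSym m N q R m ≠ 0) (htriv : skewSym (m + 1) N q R (m + 1) = 0) :
    q ^ m * C.trace = qInt q m := by
  obtain ⟨n, rfl⟩ := Nat.exists_eq_succ_of_ne_zero hm.ne'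
  have h := lastTrace_skewSym hRC (hqgen _ n.succ_pos) (hP n)
  rw [htriv, show lastTrace C (0 : Matrix (Fin (n + 2) → Fin N) _ K) = 0 by
    ext f g; simp [lastTrace], eq_comm, smul_eq_zero_iff_left hne,
    div_eq_zero_iff, or_iff_left (hqgen (n + 2) (by omega))] at h
  exact sub_eq_zero.mp h

theorem quantumTrace_skewSym (hq0 : q ≠ 0) (hqgen : ∀ n : ℕ, 0 < n → qInt q n ≠ 0)
    (hRC : ∀ i k, ∑ j, ∑ l, R (i, j) (k, l) * C l j = if i = k then 1 else 0)
    (hP : ∀ n, IsIdempotentElem (skewSym (n + 1) N q R (n + 1)))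
    (hC : q ^ m * C.trace = qInt q m) :
    q ^ (m * m) * quantumTrace C (skewSym m N q R m) = 1 := by
  have h1 := hqgen 1 one_pos
  have hstep (j : ℕ) (hj : j ≤ m) :
      q ^ m * (q ^ j * C.trace - qInt q j) = qInt q (m - j) := by
    obtain ⟨d, rfl⟩ := Nat.exists_eq_add_of_le hj
    rw [mul_sub, mul_left_comm, hC, Nat.add_sub_cancel_left]
    simp only [qInt, inv_pow]
    field_simp
    ring
  have hrec (j : ℕ) (hj : j ≤ m) :
      q ^ (m * j) * quantumTrace C (skewSym j N q R j) * ∏ i ∈ Finset.range j, qInt q (i + 1) =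
        ∏ i ∈ Finset.range j, qInt q (m - i) := by
    induction j with
    | zero => simp [quantumTrace, skewSym]
    | succ j ih =>
      have hlast : quantumTrace C (skewSym (j + 1) N q R (j + 1)) * qInt q (j + 1) =
          (q ^ j * C.trace - qInt q j) * quantumTrace C (skewSym j N q R j) := by
        rw [← quantumTrace_lastTrace]
        cases j with
        | zero =>
          simp only [skewSym]
          rw [lastTrace_one, quantumTrace_smul, zero_add, qInt_one h1]
          simp [qInt]
        | succ j =>
          rw [lastTrace_skewSym hRC (hqgen _ j.succ_pos) (hP j), quantumTrace_smul,
            mul_right_comm, div_mul_cancel₀ _ (hqgen (j + 2) (by omega))]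
      rw [Finset.prod_range_succ, Finset.prod_range_succ, ← ih (by omega), ← hstep j (by omega)]
      linear_combination (q ^ (m * (j + 1)) * ∏ i ∈ Finset.range j, qInt q (i + 1)) * hlast
  have h := hrec m le_rfl
  rw [← Finset.prod_range_reflect (fun i => qInt q (m - i))] at h
  have hprod : ∏ i ∈ Finset.range m, qInt q (m - (m - 1 - i)) =
      ∏ i ∈ Finset.range m, qInt q (i + 1) :=
    Finset.prod_congr rfl fun i hi => by
      have := Finset.mem_range.mp hi
      congr 1
      omega
  rw [hprod] at h
  exact mul_right_cancel₀
    (Finset.prod_ne_zero_iff.mpr fun i _ => hqgen (i + 1) i.succ_pos) (h.trans (one_mul _).symm)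

end QuantumDimension

theorem commute_skewSym_prod_Lbar {N m : ℕ} (hm : 0 < m) {A : Type*} [Ring A] [Algebra K A]
    {R Rinv : Matrix (Fin N × Fin N) (Fin N × Fin N) K} (q : K)
    (hbraid : liftPos 3 N R 0 * liftPos 3 N R 1 * liftPos 3 N R 0 =
      liftPos 3 N R 1 * liftPos 3 N R 0 * liftPos 3 N R 1)
    (hRinv : R * Rinv = 1 ∧ Rinv * R = 1) {L : Matrix (Fin N) (Fin N) A}
    (hRE : R.map (algebraMap K A) *
          Matrix.of (fun p q' : Fin N × Fin N => L p.1 q'.1 * (if p.2 = q'.2 then 1 else 0)) *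
          R.map (algebraMap K A) *
          Matrix.of (fun p q' : Fin N × Fin N => L p.1 q'.1 * (if p.2 = q'.2 then 1 else 0)) =
        Matrix.of (fun p q' : Fin N × Fin N => L p.1 q'.1 * (if p.2 = q'.2 then 1 else 0)) *
          R.map (algebraMap K A) *
          Matrix.of (fun p q' : Fin N × Fin N => L p.1 q'.1 * (if p.2 = q'.2 then 1 else 0)) *
          R.map (algebraMap K A)) :
    Commute ((skewSym m N q R m).map (algebraMap K A))
      ((List.range m).map (Lbar m N hm R Rinv L)).prod := by
  let φ := (Algebra.ofId K A).mapMatrix (m := Fin m → Fin N)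
  have hφ (X : Matrix (Fin m → Fin N) (Fin m → Fin N) K) : X.map (algebraMap K A) = φ X := rfl
  have hlift (i : ℕ) (hi : i + 2 ≤ m) : φ (liftPos m N R i) =
      siteLift (window i 2 m hi) (onPair (R.map (algebraMap K A))) := by
    rw [liftPos_eq_siteLift R hi, ← hφ, siteLift_map]
    rfl
  rw [hφ, skewSym_eq_antisymmetrizer, map_antisymmetrizer φ q _ (fun i => φ (liftPos m N R i)) m
    fun _ _ => rfl]
  refine (commute_antisymmetrizer q _ _ m fun i hi => Commute.symm ?_).symm
  refine commute_generator_prod_copies (r := fun i => φ (liftPos m N R i))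
    (s := fun i => φ (liftPos m N Rinv i)) (fun i => ?_) (fun i => ?_) (fun i hi => ?_)
    (fun i j hij hj => (liftPos_commute R i j hij hj).map φ) (fun i h1 hi => ?_) (fun n => rfl)
    (fun h1 => ?_) i hi
  · rw [← map_mul, liftPos_mul_inverse hRinv.1, map_one]
  · rw [← map_mul, liftPos_mul_inverse hRinv.2, map_one]
  · simpa only [map_mul] using congrArg φ (liftPos_braid hbraid i hi)
  · rw [hlift i hi, Lbar, embed1_eq_siteLift]
    exact (commute_siteLift _ _ (disjoint_range_window h1) _ _
      fun _ _ _ _ => (Algebra.commutes _ _).symm).symm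
  · have h := congrArg (fun X => siteLift (window 0 2 m h1) (onPair X)) hRE
    simpa only [onPair_mul, siteLift_mul, ← hlift 0 h1, ← embed1_two, siteLift_window_embed1, Lbar]
      using h

/-- in the Reflection Equation algebra, L_{1̄}⋯L_{m̄} commutes with
P⁽ᵐ⁾ and P⁽ᵐ⁾L_{1̄}⋯L_{m̄} = L_{1̄}⋯L_{m̄}P⁽ᵐ⁾ = q^{m²}·det_{RE}(L)·P⁽ᵐ⁾, where
det_{RE}(L) = Tr_{R(1…m)}(P⁽ᵐ⁾L_{1̄}⋯L_{m̄}). -/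
theorem RE_determinant_formula {N m : ℕ} (hm : 0 < m)
    {A : Type*} [Ring A] [Algebra K A]
    (R Rinv Ψ : Matrix (Fin N × Fin N) (Fin N × Fin N) K)
    (C : Matrix (Fin N) (Fin N) K) (q : K)
    (hq0 : q ≠ 0) (hqgen : ∀ n : ℕ, 0 < n → qInt q n ≠ 0)
    (hbraid : liftPos 3 N R 0 * liftPos 3 N R 1 * liftPos 3 N R 0 =
      liftPos 3 N R 1 * liftPos 3 N R 0 * liftPos 3 N R 1)
    (hHecke : R * R = (q - q⁻¹) • R + 1)
    (hRinv : R * Rinv = 1 ∧ Rinv * R = 1)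
    (hΨ : ∀ i p q' k : Fin N,
      (∑ j : Fin N, ∑ l : Fin N, R (i, j) (k, l) * Ψ (l, p) (j, q')) =
        (if i = q' then 1 else 0) * (if p = k then 1 else 0))
    (hCdef : ∀ i j : Fin N, C i j = ∑ s : Fin N, Ψ (i, s) (j, s))
    (hrank : Matrix.rank (skewSym m N q R m) = 1)
    (htriv : skewSym (m + 1) N q R (m + 1) = 0)
    (L : Matrix (Fin N) (Fin N) A)
    (hRE : R.map (algebraMap K A) *
          Matrix.of (fun p q' : Fin N × Fin N => L p.1 q'.1 * (if p.2 = q'.2 then 1 else 0)) *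
          R.map (algebraMap K A) *
          Matrix.of (fun p q' : Fin N × Fin N => L p.1 q'.1 * (if p.2 = q'.2 then 1 else 0)) =
        Matrix.of (fun p q' : Fin N × Fin N => L p.1 q'.1 * (if p.2 = q'.2 then 1 else 0)) *
          R.map (algebraMap K A) *
          Matrix.of (fun p q' : Fin N × Fin N => L p.1 q'.1 * (if p.2 = q'.2 then 1 else 0)) *
          R.map (algebraMap K A)) :
    (skewSym m N q R m).map (algebraMap K A) *
        ((List.range m).map (Lbar m N hm R Rinv L)).prod =
      ((List.range m).map (Lbar m N hm R Rinv L)).prod *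
        (skewSym m N q R m).map (algebraMap K A) ∧
    ∀ I J : Fin m → Fin N,
      ((skewSym m N q R m).map (algebraMap K A) *
          ((List.range m).map (Lbar m N hm R Rinv L)).prod) I J =
        algebraMap K A (q ^ (m * m) * skewSym m N q R m I J) *
          (∑ I' : Fin m → Fin N, ∑ J' : Fin m → Fin N,
            ((skewSym m N q R m).map (algebraMap K A) *
              ((List.range m).map (Lbar m N hm R Rinv L)).prod) I' J' *
              algebraMap K A (∏ t, C (J' t) (I' t))) := by
  have hRC (i k : Fin N) : ∑ j, ∑ l, R (i, j) (k, l) * C l j = if i = k then 1 else 0 := by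
    simp only [hCdef, Finset.mul_sum]
    refine ((Finset.sum_congr rfl fun j _ => Finset.sum_comm).trans Finset.sum_comm).trans ?_
    simp [hΨ]
  have hcomm := commute_skewSym_prod_Lbar hm q hbraid hRinv hRE
  have hidem := skewSym_idempotent hq0 hqgen hbraid hHecke
  refine ⟨hcomm, fun I J => ?_⟩
  set P := skewSym m N q R m
  set Λ := ((List.range m).map (Lbar m N hm R Rinv L)).prod
  have hPP : P * P = P := by
    obtain ⟨n, rfl⟩ := Nat.exists_eq_succ_of_ne_zero hm.ne'
    exact hidem n
  have hne : P ≠ 0 := by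
    intro h
    rw [h, Matrix.rank_zero] at hrank
    exact zero_ne_one hrank
  obtain ⟨s, hs⟩ := Matrix.exists_sandwich_eq_mul (A := A) hrank Λ
  have hPΛP : P.map (algebraMap K A) * Λ * P.map (algebraMap K A) = P.map (algebraMap K A) * Λ := by
    rw [mul_assoc, ← hcomm.eq, ← mul_assoc, ← Matrix.map_mul, hPP]
  rw [hPΛP] at hs
  have htrace := quantumTrace_skewSym hq0 hqgen hRC hidem
    (pow_mul_trace_eq_qInt hm hqgen hRC hidem hne htriv)
  have hdet : (∑ I', ∑ J', (P.map (algebraMap K A) * Λ) I' J' *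
      algebraMap K A (∏ t, C (J' t) (I' t))) = s * algebraMap K A (quantumTrace C P) := by
    simp only [hs, quantumTrace, map_sum, map_mul, Finset.mul_sum, mul_assoc]
  rw [hdet, hs, Algebra.commutes, mul_assoc, ← map_mul]
  congr 2
  linear_combination (-P I J) * htrace
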